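/- arXiv:1106.2204 — 4 statements merged into one kernel-verified Lean document; each statement's English description precedes it below -/
import Mathlib

section
/- Let S be a join semilattice with least element 0 and let a < b and c < d in S. For the principal eon-relations ⟨a,b⟩ and ⟨c,d⟩: ⟨a,b⟩ ⊆ ⟨c,d⟩ if and only if a ≥ c and a ∨ d ≥ b. -/
universe u

/-- An eon-relation of `(S,∨,0)` (no operators): reflexive, transitive,
compatible with join, contained in `≤`, and such that `x ≤ y ≤ z` and `x R z`
imply `x R y`. -/
def IsEon0 {S : Type u} [SemilatticeSup S] (R : S → S → Prop) : Prop :=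
  Reflexive R ∧ Transitive R ∧
    (∀ x y x' y' : S, R x y → R x' y' → R (x ⊔ x') (y ⊔ y')) ∧
    (∀ x y : S, R x y → x ≤ y) ∧
    (∀ x y z : S, x ≤ y → y ≤ z → R x z → R x y)

/-- `P` is the principal eon-relation generated by `(c,d)`: the least element of
`Eon(S,∨,0)` containing the pair `(c,d)`. -/
def IsPrincipalEon {S : Type u} [SemilatticeSup S] (c d : S) (P : S → S → Prop) : Prop :=
  IsEon0 P ∧ P c d ∧ ∀ R : S → S → Prop, IsEon0 R → R c d → ∀ x y, P x y → R x y

theorem isEon0_eq_or_le_sup {S : Type u} [SemilatticeSup S] (c d : S) :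
    IsEon0 fun x y : S => x = y ∨ (x ≤ y ∧ c ≤ x ∧ y ≤ x ⊔ d) := by
  refine ⟨fun x => Or.inl rfl, ?_, ?_, ?_, ?_⟩
  · rintro x y z (rfl | ⟨hxy, hcx, hyx⟩) (rfl | ⟨hyz, hcy, hzy⟩)
    · exact Or.inl rfl
    · exact Or.inr ⟨hyz, hcy, hzy⟩
    · exact Or.inr ⟨hxy, hcx, hyx⟩
    · exact Or.inr ⟨hxy.trans hyz, hcx, hzy.trans (sup_le hyx le_sup_right)⟩
  · rintro x y x' y' (rfl | ⟨hxy, hcx, hyx⟩) (rfl | ⟨hxy', hcx', hyx'⟩)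
    · exact Or.inl rfl
    · refine Or.inr ⟨sup_le_sup_left hxy' x, hcx'.trans le_sup_right, ?_⟩
      rw [sup_assoc]
      exact sup_le_sup_left hyx' x
    · refine Or.inr ⟨sup_le_sup_right hxy x', hcx.trans le_sup_left, ?_⟩
      rw [sup_right_comm]
      exact sup_le_sup_right hyx x'
    · refine Or.inr ⟨sup_le_sup hxy hxy', hcx.trans le_sup_left, ?_⟩
      exact sup_le (hyx.trans (sup_le_sup_right le_sup_left d))
        (hyx'.trans (sup_le_sup_right le_sup_right d))
  · rintro x y (rfl | ⟨hxy, -, -⟩)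
    · exact le_rfl
    · exact hxy
  · rintro x y z hxy hyz (rfl | ⟨-, hcx, hzx⟩)
    · exact Or.inl (le_antisymm hxy hyz)
    · exact Or.inr ⟨hxy, hcx, hyz.trans hzx⟩

/-- Let `S` be a join semilattice with least element `0`, and let
`a < b` and `c < d` in `S`.  For the principal eon-relations `⟨a,b⟩` and `⟨c,d⟩`:
`⟨a,b⟩ ⊆ ⟨c,d⟩` iff `a ≥ c` and `a ∨ d ≥ b`. -/
theorem principalEon_le_iff {S : Type u} [SemilatticeSup S] [OrderBot S]
    {a b c d : S} (hab : a < b) (hcd : c < d)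
    {P Q : S → S → Prop} (hP : IsPrincipalEon a b P) (hQ : IsPrincipalEon c d Q) :
    (∀ x y : S, P x y → Q x y) ↔ c ≤ a ∧ b ≤ a ⊔ d := by
  constructor
  · intro h
    rcases hQ.2.2 _ (isEon0_eq_or_le_sup c d) (Or.inr ⟨hcd.le, le_rfl, le_sup_right⟩)
      a b (h a b hP.2.1) with hEq | ⟨-, hca, hba⟩
    · exact absurd hEq hab.ne
    · exact ⟨hca, hba⟩
  · rintro ⟨hca, hba⟩
    obtain ⟨hrefl, -, hsup, -, hmid⟩ := hQ.1
    have hQad : Q a (a ⊔ d) := by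
      simpa only [sup_eq_left.mpr hca] using hsup a a c d (hrefl a) hQ.2.1
    exact hP.2.2 Q hQ.1 (hmid a b (a ⊔ d) hab.le hba hQad)
end

section
/- Let S be a join semilattice with least element 0. (i) For every nonempty proper ideal I of S, the equivalence relation whose two classes are I and S∖I is a congruence of (S,∨,0), and it is a coatom of the complete lattice Con(S,∨,0). (ii) Conversely, every coatom of Con(S,∨,0) is of this form: it has exactly two equivalence classes, one of which is a nonempty proper ideal of S and the other its complement. -/
universe u

/-- A congruence of `(S,∨,0)`: an equivalence relation compatible with joins. -/
def IsCong0 {S : Type u} [SemilatticeSup S] (θ : S → S → Prop) : Prop :=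
  Equivalence θ ∧ ∀ x y s : S, θ x y → θ (x ⊔ s) (y ⊔ s)

/-- An ideal of a join semilattice with `0`: a downward-closed subset containing `0`
that is closed under binary joins. -/
def IsIdealS {S : Type u} [SemilatticeSup S] [OrderBot S] (I : Set S) : Prop :=
  ⊥ ∈ I ∧ (∀ x y : S, x ≤ y → y ∈ I → x ∈ I) ∧ ∀ x y : S, x ∈ I → y ∈ I → x ⊔ y ∈ I

/-- `Con(S,∨,0)`, ordered by inclusion, with top the universal congruence. -/
instance {S : Type u} [SemilatticeSup S] :
    OrderTop {θ : S → S → Prop // IsCong0 θ} where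
  top := ⟨fun _ _ => True,
    ⟨⟨fun _ => trivial, fun _ => trivial, fun _ _ => trivial⟩, fun _ _ _ _ => trivial⟩⟩
  le_top _ := fun _ _ _ => trivial

theorem IsIdealS.sup_mem_iff {S : Type u} [SemilatticeSup S] [OrderBot S] {I : Set S}
    (hI : IsIdealS I) {x y : S} : x ⊔ y ∈ I ↔ x ∈ I ∧ y ∈ I :=
  ⟨fun h => ⟨hI.2.1 _ _ le_sup_left h, hI.2.1 _ _ le_sup_right h⟩, fun h => hI.2.2 _ _ h.1 h.2⟩

theorem IsIdealS.isCong0 {S : Type u} [SemilatticeSup S] [OrderBot S] {I : Set S}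
    (hI : IsIdealS I) : IsCong0 (fun x y => x ∈ I ↔ y ∈ I) := by
  refine ⟨⟨fun _ => Iff.rfl, Iff.symm, Iff.trans⟩, fun x y s h => ?_⟩
  simp only [hI.sup_mem_iff, h]

theorem IsCong0.isIdealS_class_bot {S : Type u} [SemilatticeSup S] [OrderBot S]
    {θ : S → S → Prop} (hθ : IsCong0 θ) : IsIdealS {x | θ x ⊥} := by
  refine ⟨hθ.1.refl ⊥, fun x y hxy hy => ?_, fun x y hx hy => ?_⟩
  · have h := hθ.2 y ⊥ x hy
    rw [sup_eq_left.2 hxy, bot_sup_eq] at h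
    exact hθ.1.trans (hθ.1.symm h) hy
  · have h := hθ.2 x ⊥ y hx
    rw [bot_sup_eq] at h
    exact hθ.1.trans h hy

/-- An equivalence relation that strictly contains the partition of `S` into a set and its
complement relates all elements. -/
theorem Equivalence.rel_of_mem_iff_le {S : Type u} {θ : S → S → Prop} (hθ : Equivalence θ)
    {I : Set S} (hle : ∀ x y, (x ∈ I ↔ y ∈ I) → θ x y) {a b : S} (hab : θ a b)
    (hne : ¬(a ∈ I ↔ b ∈ I)) (x y : S) : θ x y := by
  have key : ∀ z, θ z a := fun z => by
    by_cases hz : z ∈ I ↔ a ∈ I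
    · exact hle z a hz
    · exact hθ.trans (hle z b (by tauto)) (hθ.symm hab)
  exact hθ.trans (key x) (hθ.symm (key y))

/-- Let `S` be a join semilattice with least element `0`.
(i) For every nonempty proper ideal `I` of `S`, the equivalence relation whose two
classes are `I` and `S∖I` is a congruence of `(S,∨,0)`, and it is a coatom of
`Con(S,∨,0)`.  (ii) Conversely, every coatom of `Con(S,∨,0)` is of this form. -/
theorem coatoms_of_con {S : Type u} [SemilatticeSup S] [OrderBot S] :
    (∀ I : Set S, IsIdealS I → I.Nonempty → I ≠ Set.univ →
      ∃ h : IsCong0 (fun x y => x ∈ I ↔ y ∈ I),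
        IsCoatom (⟨fun x y => x ∈ I ↔ y ∈ I, h⟩ : {θ : S → S → Prop // IsCong0 θ})) ∧
    (∀ θ : {θ : S → S → Prop // IsCong0 θ}, IsCoatom θ →
      ∃ I : Set S, IsIdealS I ∧ I.Nonempty ∧ I ≠ Set.univ ∧
        θ.1 = fun x y => x ∈ I ↔ y ∈ I) := by
  refine ⟨fun I hI _ hne => ⟨hI.isCong0, ?_, fun θ hlt => ?_⟩, fun θ hθ => ?_⟩
  · intro htop
    refine hne (Set.eq_univ_of_forall fun x => ?_)
    have h : (x ∈ I ↔ ⊥ ∈ I) = True :=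
      congrFun (congrFun (congrArg Subtype.val htop) x) ⊥
    exact (of_eq_true h).2 hI.1
  · obtain ⟨hle, hnle⟩ := lt_iff_le_not_ge.1 hlt
    have hex : ∃ a b, θ.1 a b ∧ ¬(a ∈ I ↔ b ∈ I) := by
      by_contra! hcon
      exact hnle fun a b hab => hcon a b hab
    obtain ⟨a, b, hab, hne'⟩ := hex
    exact top_le_iff.1 fun x y _ => θ.2.1.rel_of_mem_iff_le (fun u v => hle u v) hab hne' x y
  · have hJ := θ.2.isIdealS_class_bot
    have hne : {x | θ.1 x ⊥} ≠ Set.univ := fun h => hθ.1 <| top_le_iff.1 fun x y _ =>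
      θ.2.1.trans (Set.eq_univ_iff_forall.1 h x) (θ.2.1.symm (Set.eq_univ_iff_forall.1 h y))
    refine ⟨{x | θ.1 x ⊥}, hJ, ⟨⊥, hJ.1⟩, hne, ?_⟩
    have hle : θ ≤ ⟨_, hJ.isCong0⟩ := fun x y hxy =>
      ⟨fun h => θ.2.1.trans (θ.2.1.symm hxy) h, fun h => θ.2.1.trans hxy h⟩
    rcases hle.eq_or_lt with h | h
    · exact congrArg Subtype.val h
    · refine absurd (Set.eq_univ_of_forall fun x => ?_) hne
      have h' := congrFun (congrFun (congrArg Subtype.val (hθ.2 _ h)) x) ⊥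
      exact (of_eq_true h').2 hJ.1
end

section
/- Let S be a join semilattice with least element 0 and greatest element 1, and let M be a monoid (under composition) of operators on S that is reductive (for every f, g ∈ M there exists h ∈ M with f = h∘g or g = h∘f) and right cancellative (g∘f = h∘f implies g = h), such that f(1) = 1 for every f ∈ M. Then there exist a first-order language L and a set T₀ of quasi-identities in L such that the lattice QTh(T₀) of quasi-equational theories extending T₀, ordered by inclusion, is order-isomorphic to Con(S,∨,0,M). -/
open FirstOrder FirstOrder.Language

universe u

/-- A quasi-identity whose matrix has `n` universally quantified variables. -/
def IsQuasiIdentityN {L : FirstOrder.Language.{u, u}} (n : ℕ) (σ : L.Sentence) : Prop :=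
  ∃ (hyps : List (L.BoundedFormula Empty n)) (concl : L.BoundedFormula Empty n),
    (∀ φ ∈ hyps, φ.IsAtomic) ∧ concl.IsAtomic ∧
      σ = BoundedFormula.alls ((hyps.foldr (· ⊓ ·) ⊤).imp concl)

/-- A quasi-identity: the universal closure of an implication whose premise is a
finite (possibly empty) conjunction of atomic formulas and whose conclusion is an
atomic formula. -/
def IsQuasiIdentity {L : FirstOrder.Language.{u, u}} (σ : L.Sentence) : Prop :=
  ∃ n, IsQuasiIdentityN n σ

/-- A quasi-equational theory extending `T₀`: a set `T` of quasi-identities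
containing `T₀` such that every quasi-identity true in all models of `T` belongs
to `T`. -/
def IsQETheory {L : FirstOrder.Language.{u, u}} (T₀ T : L.Theory) : Prop :=
  T₀ ⊆ T ∧ (∀ σ ∈ T, IsQuasiIdentity σ) ∧
    ∀ σ : L.Sentence, IsQuasiIdentity σ → T ⊨ᵇ σ → σ ∈ T

/-- An operator on a join semilattice with least element 0: a map preserving
binary joins and 0. -/
def IsOperator {S : Type u} [SemilatticeSup S] [OrderBot S] (f : S → S) : Prop :=
  (∀ x y : S, f (x ⊔ y) = f x ⊔ f y) ∧ f ⊥ = ⊥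

/-- A congruence of `(S,∨,0,M)`: an equivalence relation compatible with joins
and with every operator in `M`. -/
def IsCong {S : Type u} [SemilatticeSup S] (M : Set (S → S)) (θ : S → S → Prop) : Prop :=
  Equivalence θ ∧ (∀ x y s : S, θ x y → θ (x ⊔ s) (y ⊔ s)) ∧
    (∀ f ∈ M, ∀ x y : S, θ x y → θ (f x) (f y))

namespace OperatorModel

/-- Function symbols: one constant, and a unary symbol for each operator. -/
inductive Func {S : Type u} (M : Set (S → S)) : ℕ → Type u
  | pt : Func M 0
  | op (f : M) : Func M 1

/-- Relation symbols: a unary predicate for each element of the semilattice. -/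
inductive Pred (S : Type u) : ℕ → Type u
  | mem (s : S) : Pred S 1

/-- The language with a constant, unary operations from `M` and unary predicates from `S`. -/
def lang {S : Type u} (M : Set (S → S)) : FirstOrder.Language.{u, u} := ⟨Func M, Pred S⟩

variable {S : Type u} {M : Set (S → S)}

section Operations

variable (M) (A : Type u) [(lang M).Structure A]

/-- The distinguished element of a structure. -/
def pt : A := Structure.funMap (L := lang M) Func.pt Fin.elim0

variable {A}

/-- The unary operation attached to `f ∈ M`. -/
def app (f : M) (x : A) : A := Structure.funMap (L := lang M) (Func.op f) fun _ => x

/-- The unary predicate attached to `s : S`. -/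
def Holds (s : S) (x : A) : Prop := Structure.RelMap (L := lang M) (Pred.mem s) fun _ => x

/-- Iterated application of a word in `M`; the head of the list is applied last. -/
def act (w : List M) (x : A) : A := w.foldr (app M) x

end Operations

/-- The element `s'` of `S` such that `s` holds at `w x` exactly when `s'` holds at `x`. -/
def pull (w : List M) (s : S) : S := w.foldl (fun t f => f.1 t) s

theorem pull_bot [SemilatticeSup S] [OrderBot S] (hop : ∀ f ∈ M, IsOperator f) (w : List M) : pull w (⊥ : S) = ⊥ := by
  induction w with
  | nil => rfl
  | cons f w ih =>
    change pull w (f.1 ⊥) = ⊥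
    rw [(hop f.1 f.2).2, ih]

theorem pull_top [SemilatticeSup S] [OrderTop S]
    (htop : ∀ f ∈ M, f ⊤ = (⊤ : S)) (w : List M) : pull w (⊤ : S) = ⊤ := by
  induction w with
  | nil => rfl
  | cons f w ih =>
    change pull w (f.1 ⊤) = ⊤
    rw [htop f.1 f.2, ih]

theorem pull_sup [SemilatticeSup S] [OrderBot S] (hop : ∀ f ∈ M, IsOperator f) (w : List M) (s t : S) :
    pull w (s ⊔ t) = pull w s ⊔ pull w t := by
  induction w generalizing s t with
  | nil => rfl
  | cons f w ih =>
    change pull w (f.1 (s ⊔ t)) = _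
    rw [(hop f.1 f.2).1, ih]
    rfl

theorem pull_cong [SemilatticeSup S] {θ : S → S → Prop} (hθ : IsCong M θ) (w : List M) {s t : S} (h : θ s t) :
    θ (pull w s) (pull w t) := by
  induction w generalizing s t with
  | nil => exact h
  | cons f w ih => exact ih (hθ.2.2 f.1 f.2 s t h)

section Formulas

/-- The constant as a term. -/
def ptTerm (M : Set (S → S)) (α : Type) : (lang M).Term α := Term.func Func.pt Fin.elim0

/-- A word applied to a term. -/
def wordTerm {α : Type} (w : List M) (t : (lang M).Term α) : (lang M).Term α :=
  w.foldr (fun f t => Term.func (Func.op f) fun _ => t) t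

/-- The atomic formula asserting that `s` holds at a term. -/
def holdsFormula {n : ℕ} (M : Set (S → S)) (s : S) (t : (lang M).Term (Empty ⊕ Fin n)) :
    (lang M).BoundedFormula Empty n :=
  BoundedFormula.rel (L := lang M) (Pred.mem s) fun _ => t

/-- The universal closure of an implication from a finite conjunction. -/
def quasi {L : FirstOrder.Language.{u, u}} {n : ℕ} (hyps : List (L.BoundedFormula Empty n))
    (concl : L.BoundedFormula Empty n) : L.Sentence :=
  BoundedFormula.alls ((hyps.foldr (· ⊓ ·) ⊤).imp concl)

theorem isQuasiIdentity_quasi {L : FirstOrder.Language.{u, u}} {n : ℕ}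
    {hyps : List (L.BoundedFormula Empty n)} {concl : L.BoundedFormula Empty n}
    (hh : ∀ φ ∈ hyps, φ.IsAtomic) (hc : concl.IsAtomic) : IsQuasiIdentity (quasi hyps concl) :=
  ⟨n, hyps, concl, hh, hc, rfl⟩

theorem realize_quasi {L : FirstOrder.Language.{u, u}} {n : ℕ} (A : Type u) [L.Structure A]
    {hyps : List (L.BoundedFormula Empty n)} {concl : L.BoundedFormula Empty n} :
    A ⊨ quasi hyps concl ↔ ∀ v : Fin n → A,
      (∀ φ ∈ hyps, φ.Realize (default : Empty → A) v) →
        concl.Realize (default : Empty → A) v := by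
  simp only [quasi, Sentence.Realize, BoundedFormula.realize_alls,
    BoundedFormula.realize_imp, BoundedFormula.realize_foldr_inf]

theorem isAtomic_holdsFormula {n : ℕ} (s : S) (t : (lang M).Term (Empty ⊕ Fin n)) :
    (holdsFormula M s t).IsAtomic :=
  BoundedFormula.IsAtomic.rel _ _

variable {A : Type u} [(lang M).Structure A] {α : Type}

@[simp] theorem realize_ptTerm (v : α → A) : (ptTerm M α).realize v = pt M A := by
  simp only [ptTerm, Term.realize, pt]
  congr 1
  exact Subsingleton.elim _ _

@[simp] theorem realize_wordTerm (w : List M) (t : (lang M).Term α) (v : α → A) :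
    (wordTerm w t).realize v = act M w (t.realize v) := by
  induction w with
  | nil => rfl
  | cons f w ih =>
    change app M f ((wordTerm w t).realize v) = _
    rw [ih]
    rfl

@[simp] theorem realize_holdsFormula {n : ℕ} (s : S) (t : (lang M).Term (Empty ⊕ Fin n))
    (v : Empty → A) (xs : Fin n → A) :
    (holdsFormula M s t).Realize v xs ↔ Holds M s (t.realize (Sum.elim v xs)) :=
  Iff.rfl

theorem realize_mem {n : ℕ} (s : S) (ts : Fin 1 → (lang M).Term (Empty ⊕ Fin n))
    (v : Empty → A) (xs : Fin n → A) :
    (Relations.boundedFormula (L := lang M) (Pred.mem s) ts).Realize v xs ↔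
      Holds M s ((ts 0).realize (Sum.elim v xs)) := by
  have h : ts = fun _ => ts 0 := funext fun i => by rw [Subsingleton.elim i 0]
  rw [h]
  exact Iff.rfl

theorem realize_pt (ts : Fin 0 → (lang M).Term α) (v : α → A) :
    (Term.func (L := lang M) Func.pt ts).realize v = pt M A := by
  obtain rfl : ts = Fin.elim0 := Subsingleton.elim _ _
  exact realize_ptTerm v

end Formulas

section Act

variable {A : Type u} [(lang M).Structure A]

@[simp] theorem act_nil (x : A) : act M [] x = x := rfl

@[simp] theorem act_cons (f : M) (w : List M) (x : A) :
    act M (f :: w) x = app M f (act M w x) := rfl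

theorem act_append (u w : List M) (x : A) : act M (u ++ w) x = act M u (act M w x) := by
  simp [act, List.foldr_append]

end Act

/-- The quasi-identity `∀ x, s x → t x`. -/
def impl (M : Set (S → S)) (s t : S) : (lang M).Sentence :=
  quasi (n := 1) [holdsFormula M s (&0)] (holdsFormula M t (&0))

theorem isQuasiIdentity_impl (s t : S) : IsQuasiIdentity (impl M s t) :=
  isQuasiIdentity_quasi (by simp [isAtomic_holdsFormula]) (isAtomic_holdsFormula _ _)

theorem realize_impl {A : Type u} [(lang M).Structure A] {s t : S} :
    A ⊨ impl M s t ↔ ∀ x : A, Holds M s x → Holds M t x := by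
  rw [impl, realize_quasi]
  simp only [List.mem_singleton, forall_eq, realize_holdsFormula]
  exact ⟨fun h x => h fun _ => x, fun h v => h (v 0)⟩

theorem holds_of_impl_mem {T : (lang M).Theory} {s t : S} (h : impl M s t ∈ T) {A : Type u} [(lang M).Structure A]
    (hA : A ⊨ T) (x : A) (hx : Holds M s x) : Holds M t x :=
  realize_impl.1 (hA.realize_of_mem _ h) x hx

/-- The structure freely generated by one point whose set of predicates is `I`, together with the
distinguished point `none`. -/
def Free (M : Set (S → S)) (_I : Set S) : Type u := Option (List M)

instance (I : Set S) : (lang M).Structure (Free M I) where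
  funMap := fun g xs => match g with
    | Func.pt => (none : Option (List M))
    | Func.op f => Option.map (List.cons f) (xs 0)
  RelMap := fun R xs => match R with
    | Pred.mem s => ∀ w : List M, xs 0 = some w → pull w s ∈ I

/-- The point of the free structure given by a word. -/
def Free.of (I : Set S) (w : List M) : Free M I := some w

theorem act_free_of {I : Set S} (u w : List M) :
    act M u (Free.of I w) = Free.of I (u ++ w) := by
  induction u with
  | nil => rfl
  | cons f u ih => rw [act_cons, ih]; rfl

variable [SemilatticeSup S] [OrderBot S] [OrderTop S]

/-- The structures in which predicates form ideals of `S` compatible with the operators, the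
distinguished point is the unique point where `⊤` holds, and away from it the operators act
freely. -/
structure IsBase (M : Set (S → S)) (A : Type u) [(lang M).Structure A] : Prop where
  bot : ∀ x : A, Holds M ⊥ x
  sup : ∀ (s t : S) (x : A), Holds M s x → Holds M t x → Holds M (s ⊔ t) x
  mono : ∀ (s t : S) (x : A), s ≤ t → Holds M t x → Holds M s x
  app_iff : ∀ (f : M) (s : S) (x : A), Holds M s (app M f x) ↔ Holds M (f.1 s) x
  app_pt : ∀ f : M, app M f (pt M A) = pt M A
  top_pt : Holds M ⊤ (pt M A)
  eq_pt : ∀ x : A, Holds M ⊤ x → x = pt M A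
  app_inj : ∀ (f : M) (x y : A), app M f x = app M f y → x = y
  app_ne : ∀ (f g : M) (x y : A), f ≠ g → app M f x = app M g y → x = pt M A
  act_free : ∀ (u w : List M) (x : A), u ≠ w → act M u x = act M w x → x = pt M A

/-- The quasi-identities valid in all base structures satisfying `s x → t x` whenever
`θ s t`. -/
def theoryOf (M : Set (S → S)) (θ : S → S → Prop) : (lang M).Theory :=
  {σ | IsQuasiIdentity σ ∧ ∀ (A : Type u) [(lang M).Structure A], IsBase M A →
    (∀ s t, θ s t → ∀ x : A, Holds M s x → Holds M t x) → A ⊨ σ}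

theorem theoryOf_mono {θ θ' : S → S → Prop} (h : ∀ s t, θ s t → θ' s t) :
    theoryOf M θ ⊆ theoryOf M θ' :=
  fun _ hσ => ⟨hσ.1, fun A _ hA hθ => hσ.2 A hA fun s t hst => hθ s t (h s t hst)⟩

/-- The quasi-identities valid in all base structures. -/
def baseTheory (M : Set (S → S)) : (lang M).Theory := theoryOf M fun _ _ => False

theorem quasi_mem_baseTheory {n : ℕ} {hyps : List ((lang M).BoundedFormula Empty n)}
    {concl : (lang M).BoundedFormula Empty n}
    (hh : ∀ φ ∈ hyps, φ.IsAtomic) (hc : concl.IsAtomic)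
    (h : ∀ (A : Type u) [(lang M).Structure A], IsBase M A → ∀ v : Fin n → A,
      (∀ φ ∈ hyps, φ.Realize (default : Empty → A) v) →
        concl.Realize (default : Empty → A) v) :
    quasi hyps concl ∈ baseTheory M :=
  ⟨isQuasiIdentity_quasi hh hc, fun A _ hA _ => (realize_quasi A).2 (h A hA)⟩

theorem isBase_of_models {A : Type u} [(lang M).Structure A] (hA : A ⊨ baseTheory M) :
    IsBase M A := by
  have key : ∀ {n : ℕ} (hyps : List ((lang M).BoundedFormula Empty n))
      (concl : (lang M).BoundedFormula Empty n),
      (∀ φ ∈ hyps, φ.IsAtomic) → concl.IsAtomic →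
      (∀ (B : Type u) [(lang M).Structure B], IsBase M B → ∀ v : Fin n → B,
        (∀ φ ∈ hyps, φ.Realize (default : Empty → B) v) →
          concl.Realize (default : Empty → B) v) →
      ∀ v : Fin n → A, (∀ φ ∈ hyps, φ.Realize (default : Empty → A) v) →
          concl.Realize (default : Empty → A) v := fun hyps concl hh hc h =>
    (realize_quasi A).1 (hA.realize_of_mem _ (quasi_mem_baseTheory hh hc h))
  have eq_at : ∀ {n : ℕ} (t t' : (lang M).Term (Empty ⊕ Fin n)), (t.bdEqual t').IsAtomic :=
    fun t t' => BoundedFormula.IsAtomic.equal t t'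
  constructor
  · intro x
    simpa using key (n := 1) [] (holdsFormula M ⊥ (&0)) (by simp) (isAtomic_holdsFormula _ _)
      (fun B _ hB v _ => by simpa using hB.bot (v 0)) (fun _ => x)
  · intro s t x
    simpa using key (n := 1) [holdsFormula M s (&0), holdsFormula M t (&0)]
      (holdsFormula M (s ⊔ t) (&0)) (by simp [isAtomic_holdsFormula]) (isAtomic_holdsFormula _ _)
      (fun B _ hB v => by simpa using hB.sup s t (v 0)) (fun _ => x)
  · intro s t x hst
    simpa using key (n := 1) [holdsFormula M t (&0)]
      (holdsFormula M s (&0)) (by simp [isAtomic_holdsFormula]) (isAtomic_holdsFormula _ _)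
      (fun B _ hB v => by simpa using hB.mono s t (v 0) hst) (fun _ => x)
  · intro f s x
    constructor
    · simpa using key (n := 1) [holdsFormula M s (wordTerm [f] (&0))]
        (holdsFormula M (f.1 s) (&0)) (by simp [isAtomic_holdsFormula])
        (isAtomic_holdsFormula _ _)
        (fun B _ hB v => by simpa using (hB.app_iff f s (v 0)).1) (fun _ => x)
    · simpa using key (n := 1) [holdsFormula M (f.1 s) (&0)]
        (holdsFormula M s (wordTerm [f] (&0))) (by simp [isAtomic_holdsFormula])
        (isAtomic_holdsFormula _ _)
        (fun B _ hB v => by simpa using (hB.app_iff f s (v 0)).2) (fun _ => x)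
  · intro f
    simpa using key (n := 0) [] ((wordTerm [f] (ptTerm M _)).bdEqual (ptTerm M _)) (by simp)
      (eq_at _ _) (fun B _ hB v _ => by simpa using hB.app_pt f) Fin.elim0
  · simpa using key (n := 0) [] (holdsFormula M ⊤ (ptTerm M _)) (by simp)
      (isAtomic_holdsFormula _ _) (fun B _ hB v _ => by simpa using hB.top_pt) Fin.elim0
  · intro x
    simpa using key (n := 1) [holdsFormula M ⊤ (&0)] ((&0).bdEqual (ptTerm M _))
      (by simp [isAtomic_holdsFormula]) (eq_at _ _)
      (fun B _ hB v => by simpa using hB.eq_pt (v 0)) (fun _ => x)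
  · intro f x y
    simpa using key (n := 2) [(wordTerm [f] (&0)).bdEqual (wordTerm [f] (&1))]
      ((&0).bdEqual (&1)) (by simp [eq_at]) (eq_at _ _)
      (fun B _ hB v => by simpa using hB.app_inj f (v 0) (v 1)) ![x, y]
  · intro f g x y hfg
    simpa using key (n := 2) [(wordTerm [f] (&0)).bdEqual (wordTerm [g] (&1))]
      ((&0).bdEqual (ptTerm M _)) (by simp [eq_at]) (eq_at _ _)
      (fun B _ hB v => by simpa using hB.app_ne f g (v 0) (v 1) hfg) ![x, y]
  · intro u w x huw
    simpa using key (n := 1) [(wordTerm u (&0)).bdEqual (wordTerm w (&0))]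
      ((&0).bdEqual (ptTerm M _)) (by simp [eq_at]) (eq_at _ _)
      (fun B _ hB v => by simpa using hB.act_free u w (v 0) huw) (fun _ => x)

namespace IsBase

variable {A : Type u} [(lang M).Structure A]

theorem holds_pt (hA : IsBase M A) (s : S) : Holds M s (pt M A) :=
  hA.mono s ⊤ _ le_top hA.top_pt

theorem act_pt (hA : IsBase M A) (w : List M) : act M w (pt M A) = pt M A := by
  induction w with
  | nil => rfl
  | cons f w ih => rw [act_cons, ih, hA.app_pt]

theorem eq_pt_of_act (hA : IsBase M A) {w : List M} {x : A} (h : act M w x = pt M A) :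
    x = pt M A := by
  induction w with
  | nil => exact h
  | cons f w ih => exact ih (hA.app_inj f _ _ (by rw [hA.app_pt, ← act_cons, h]))

theorem holds_act (hA : IsBase M A) (w : List M) (s : S) (x : A) :
    Holds M s (act M w x) ↔ Holds M (pull w s) x := by
  induction w generalizing s with
  | nil => rfl
  | cons f w ih => rw [act_cons, hA.app_iff, ih]; rfl

/-- Two points with a common image away from the distinguished point are comparable. -/
theorem comparable (hA : IsBase M A) {x b : A} (hb : b ≠ pt M A) {u w : List M}
    (h : act M u x = act M w b) : (∃ w', act M w' b = x) ∨ ∃ u', act M u' x = b := by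
  induction u generalizing w with
  | nil => exact Or.inl ⟨w, h.symm⟩
  | cons f u ih =>
    cases w with
    | nil => exact Or.inr ⟨f :: u, h⟩
    | cons g w =>
      rw [act_cons, act_cons] at h
      by_cases hfg : f = g
      · subst hfg
        exact ih (hA.app_inj f _ _ h)
      · exact absurd (hA.eq_pt_of_act (hA.app_ne g f _ _ (Ne.symm hfg) h.symm)) hb

/-- Below any point other than the distinguished one there is a point `b` such that every entry
of a given finite tuple either lies in the orbit of `b` or never enters that orbit. -/
theorem exists_root (hA : IsBase M A) {n : ℕ} (v : Fin n → A) {a : A} (ha : a ≠ pt M A) :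
    ∃ b, b ≠ pt M A ∧ (∃ w, act M w b = a) ∧
      ∀ i, (∃ w, act M w b = v i) ∨ ∀ u w, act M u (v i) ≠ act M w b := by
  classical
  let N : A → ℕ := fun b => (Finset.univ.filter fun i => ∃ w, act M w b = v i).card
  have hN : ∀ b, N b ≤ n := fun b => (Finset.card_filter_le _ _).trans (by simp)
  obtain ⟨b, ⟨hb, hab⟩, hmax⟩ : ∃ b, (b ≠ pt M A ∧ ∃ w, act M w b = a) ∧
      ∀ c, (c ≠ pt M A ∧ ∃ w, act M w c = a) → n - N b ≤ n - N c := by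
    obtain ⟨b, hb, hmin⟩ := (measure fun b => n - N b).wf.has_min
      {b | b ≠ pt M A ∧ ∃ w, act M w b = a} ⟨a, ha, [], rfl⟩
    exact ⟨b, hb, fun c hc => not_lt.1 (hmin c hc)⟩
  refine ⟨b, hb, hab, fun i => ?_⟩
  by_contra! hcon
  obtain ⟨hi, u, w, huw⟩ := hcon
  rcases hA.comparable hb huw with ⟨w', hw'⟩ | ⟨u', hu'⟩
  · exact hi w' hw'
  obtain ⟨wa, hwa⟩ := hab
  have hvi : v i ≠ pt M A := fun h => hb (by rw [← hu', h, hA.act_pt])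
  have hlt : N b < N (v i) := by
    refine Finset.card_lt_card ((Finset.ssubset_iff_of_subset ?_).2 ⟨i, ?_, ?_⟩)
    · intro k hk
      obtain ⟨wk, hwk⟩ := (Finset.mem_filter.1 hk).2
      exact Finset.mem_filter.2 ⟨Finset.mem_univ _, wk ++ u', by rw [act_append, hu', hwk]⟩
    · exact Finset.mem_filter.2 ⟨Finset.mem_univ _, [], rfl⟩
    · intro h
      obtain ⟨w', hw'⟩ := (Finset.mem_filter.1 h).2
      exact hi w' hw'
  have := hmax (v i) ⟨hvi, wa ++ u', by rw [act_append, hu', hwa]⟩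
  have := hN (v i)
  omega

end IsBase

/-- Evaluation of a template at a point: a word is applied to the point, `none` denotes the
distinguished point. -/
def evalAt (M : Set (S → S)) {B : Type u} [(lang M).Structure B] (y : B) :
    Option (List M) → B
  | none => pt M B
  | some w => act M w y

/-- The point `x` has template `o` relative to `b`. -/
def HasTemplate (M : Set (S → S)) {A : Type u} [(lang M).Structure A] (b x : A) :
    Option (List M) → Prop
  | none => ∀ u w, act M u x ≠ act M w b
  | some w => act M w b = x

section Transfer

variable {A : Type u} [(lang M).Structure A] {n : ℕ} {v : Fin n → A} {b : A}
  {c : Fin n → Option (List M)}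

theorem exists_term_template (hA : IsBase M A) (hb : b ≠ pt M A)
    (hc : ∀ i, HasTemplate M b (v i) (c i)) (t : (lang M).Term (Empty ⊕ Fin n)) :
    ∃ o, HasTemplate M b (t.realize (Sum.elim default v)) o ∧
      ∀ (B : Type u) [(lang M).Structure B], IsBase M B → ∀ y : B,
        t.realize (Sum.elim default fun i => evalAt M y (c i)) = evalAt M y o := by
  induction t with
  | var x =>
    rcases x with x | i
    · exact x.elim
    · exact ⟨c i, hc i, fun B _ _ y => rfl⟩
  | func g ts ih =>
    cases g with
    | pt =>
      refine ⟨none, fun u w h => ?_, fun B _ _ y => ?_⟩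
      · rw [realize_pt, hA.act_pt] at h
        exact hb (hA.eq_pt_of_act h.symm)
      · exact realize_pt ts _
    | op f =>
      have hr : ∀ {B : Type u} [(lang M).Structure B] (z : Empty ⊕ Fin n → B),
          (Term.func (L := lang M) (Func.op f) ts).realize z = app M f ((ts 0).realize z) :=
        fun z => congrArg _ (funext fun i => by rw [Subsingleton.elim i 0])
      obtain ⟨o, ho, hB⟩ := ih 0
      rcases o with _ | w
      · refine ⟨none, fun u w h => ?_, fun B _ hBb y => ?_⟩
        · rw [hr] at h
          exact ho (u ++ [f]) w (by rw [act_append]; exact h)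
        · rw [hr, hB B hBb y]
          exact hBb.app_pt f
      · refine ⟨some (f :: w), ?_, fun B _ hBb y => ?_⟩
        · rw [hr]
          exact congrArg (app M f) ho
        · rw [hr, hB B hBb y]
          rfl

theorem exists_premise_of_atomic (hA : IsBase M A) (hb : b ≠ pt M A)
    (hc : ∀ i, HasTemplate M b (v i) (c i)) {φ : (lang M).BoundedFormula Empty n}
    (hφ : φ.IsAtomic) (hv : φ.Realize default v) :
    ∃ p, Holds M p b ∧ ∀ (B : Type u) [(lang M).Structure B], IsBase M B → ∀ y : B,
      Holds M p y → φ.Realize default fun i => evalAt M y (c i) := by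
  cases hφ with
  | equal t₁ t₂ =>
    obtain ⟨o₁, h₁, hB₁⟩ := exists_term_template hA hb hc t₁
    obtain ⟨o₂, h₂, hB₂⟩ := exists_term_template hA hb hc t₂
    rw [BoundedFormula.realize_bdEqual] at hv
    rw [hv] at h₁
    have ho : o₁ = o₂ := by
      rcases o₁ with _ | w₁ <;> rcases o₂ with _ | w₂
      · rfl
      · exact absurd h₂.symm (h₁ [] w₂)
      · exact absurd h₁.symm (h₂ [] w₁)
      · by_contra hne
        exact hb (hA.act_free w₁ w₂ b (fun h => hne (by rw [h])) (Eq.trans h₁ (Eq.symm h₂)))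
    refine ⟨⊥, hA.bot b, fun B _ hB y _ => ?_⟩
    rw [BoundedFormula.realize_bdEqual, hB₁ B hB, hB₂ B hB, ho]
  | rel R ts =>
    cases R with
    | mem s =>
      have hr : ∀ {B : Type u} [(lang M).Structure B] (z : Fin n → B),
          (Relations.boundedFormula (L := lang M) (Pred.mem s) ts).Realize default z ↔
            Holds M s ((ts 0).realize (Sum.elim default z)) := fun z => realize_mem s ts _ z
      obtain ⟨o, ho, hB⟩ := exists_term_template hA hb hc (ts 0)
      rw [hr] at hv
      rcases o with _ | w
      · refine ⟨⊥, hA.bot b, fun B _ hBb y _ => ?_⟩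
        rw [hr, hB B hBb]
        exact hBb.holds_pt s
      · refine ⟨pull w s, ?_, fun B _ hBb y hy => ?_⟩
        · rw [← hA.holds_act]
          exact Eq.symm ho ▸ hv
        · rw [hr, hB B hBb]
          exact (hBb.holds_act w s y).2 hy

theorem exists_premise_of_list (hA : IsBase M A) (hb : b ≠ pt M A)
    (hc : ∀ i, HasTemplate M b (v i) (c i)) (hyps : List ((lang M).BoundedFormula Empty n))
    (hh : ∀ φ ∈ hyps, φ.IsAtomic) (hv : ∀ φ ∈ hyps, φ.Realize default v) :
    ∃ p, Holds M p b ∧ ∀ (B : Type u) [(lang M).Structure B], IsBase M B → ∀ y : B,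
      Holds M p y → ∀ φ ∈ hyps, φ.Realize default fun i => evalAt M y (c i) := by
  induction hyps with
  | nil => exact ⟨⊥, hA.bot b, by simp⟩
  | cons φ l ih =>
    rw [List.forall_mem_cons] at hh hv
    obtain ⟨p, hp, hpB⟩ := exists_premise_of_atomic hA hb hc hh.1 hv.1
    obtain ⟨q, hq, hqB⟩ := ih hh.2 hv.2
    refine ⟨p ⊔ q, hA.sup p q b hp hq, fun B _ hB y hy => List.forall_mem_cons.2
      ⟨hpB B hB y (hB.mono _ _ _ le_sup_left hy), hqB B hB y (hB.mono _ _ _ le_sup_right hy)⟩⟩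

end Transfer

/-- An atomic formula failing at a tuple has a witness `a` such that, relative to any point `b`
with `a` in its orbit, the formula entails a predicate failing at `b`. -/
theorem exists_conclusion_of_atomic {A : Type u} [(lang M).Structure A] (hA : IsBase M A) {n : ℕ}
    {v : Fin n → A} {φ : (lang M).BoundedFormula Empty n} (hφ : φ.IsAtomic)
    (hv : ¬ φ.Realize default v) :
    ∃ a, a ≠ pt M A ∧ ∀ b, b ≠ pt M A → (∃ w, act M w b = a) →
      ∀ c : Fin n → Option (List M), (∀ i, HasTemplate M b (v i) (c i)) →
        ∃ q, ¬ Holds M q b ∧ ∀ (B : Type u) [(lang M).Structure B], IsBase M B → ∀ y : B,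
          (φ.Realize default fun i => evalAt M y (c i)) → Holds M q y := by
  cases hφ with
  | equal t₁ t₂ =>
    rw [BoundedFormula.realize_bdEqual] at hv
    have main : ∀ b, b ≠ pt M A →
        ((∃ w, act M w b = t₁.realize (Sum.elim default v)) ∨
          ∃ w, act M w b = t₂.realize (Sum.elim default v)) →
        ∀ c : Fin n → Option (List M), (∀ i, HasTemplate M b (v i) (c i)) →
        ∃ q, ¬ Holds M q b ∧ ∀ (B : Type u) [(lang M).Structure B], IsBase M B → ∀ y : B,
          ((t₁.bdEqual t₂).Realize default fun i => evalAt M y (c i)) → Holds M q y := by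
      intro b hb hab c hc
      obtain ⟨o₁, h₁, hB₁⟩ := exists_term_template hA hb hc t₁
      obtain ⟨o₂, h₂, hB₂⟩ := exists_term_template hA hb hc t₂
      refine ⟨⊤, fun h => hb (hA.eq_pt b h), fun B _ hB y hy => ?_⟩
      rw [BoundedFormula.realize_bdEqual, hB₁ B hB, hB₂ B hB] at hy
      suffices y = pt M B from this ▸ hB.top_pt
      rcases o₁ with _ | w₁ <;> rcases o₂ with _ | w₂
      · rcases hab with ⟨w, hw⟩ | ⟨w, hw⟩
        · exact absurd hw.symm (h₁ [] w)
        · exact absurd hw.symm (h₂ [] w)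
      · exact hB.eq_pt_of_act hy.symm
      · exact hB.eq_pt_of_act hy
      · refine hB.act_free w₁ w₂ y (fun h => hv ?_) hy
        subst h
        exact Eq.trans (Eq.symm h₁) h₂
    by_cases h₁ : t₁.realize (Sum.elim default v) = pt M A
    · exact ⟨_, fun h₂ => hv (h₁.trans h₂.symm), fun b hb hab => main b hb (Or.inr hab)⟩
    · exact ⟨_, h₁, fun b hb hab => main b hb (Or.inl hab)⟩
  | rel R ts =>
    cases R with
    | mem s =>
      have hr : ∀ {B : Type u} [(lang M).Structure B] (z : Fin n → B),
          (Relations.boundedFormula (L := lang M) (Pred.mem s) ts).Realize default z ↔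
            Holds M s ((ts 0).realize (Sum.elim default z)) := fun z => realize_mem s ts _ z
      rw [hr] at hv
      refine ⟨(ts 0).realize (Sum.elim default v), fun h => hv (h ▸ hA.holds_pt s),
        fun b hb hab c hc => ?_⟩
      obtain ⟨o, ho, hB⟩ := exists_term_template hA hb hc (ts 0)
      obtain ⟨w', hw'⟩ := hab
      rcases o with _ | w
      · exact absurd hw'.symm (ho [] w')
      · refine ⟨pull w s, fun h => hv ?_, fun B _ hBb y hy => ?_⟩
        · rw [← hA.holds_act] at h
          exact Eq.subst (motive := Holds M s) ho h
        · rw [hr, hB B hBb] at hy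
          exact (hBb.holds_act w s y).1 hy

/-- The congruence attached to a theory. -/
def rel (T : (lang M).Theory) (s t : S) : Prop := impl M s t ∈ T ∧ impl M t s ∈ T

section Theories

variable {T : (lang M).Theory}

theorem isBase_of_isQETheory (hT : IsQETheory (baseTheory M) T) {A : Type u}
    [(lang M).Structure A] (hA : A ⊨ T) : IsBase M A :=
  isBase_of_models (hA.mono hT.1)

theorem mem_of_forall_models (hT : IsQETheory (baseTheory M) T) {σ : (lang M).Sentence}
    (hσ : IsQuasiIdentity σ)
    (h : ∀ (A : Type u) [(lang M).Structure A], A ⊨ T → A ⊨ σ) : σ ∈ T :=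
  hT.2.2 σ hσ (Theory.models_sentence_iff.2 fun A => h A A.is_model)

theorem impl_mem (hT : IsQETheory (baseTheory M) T) {s t : S}
    (h : ∀ (A : Type u) [(lang M).Structure A], A ⊨ T → IsBase M A →
      ∀ x : A, Holds M s x → Holds M t x) : impl M s t ∈ T :=
  mem_of_forall_models hT (isQuasiIdentity_impl s t) fun A _ hA =>
    realize_impl.2 (h A hA (isBase_of_isQETheory hT hA))

/-- A theory is determined by its congruence. -/
theorem subset_theoryOf_rel (hT : IsQETheory (baseTheory M) T) : T ⊆ theoryOf M (rel T) := by
  refine fun σ hσ => ⟨hT.2.1 σ hσ, fun A _ hA hθ => ?_⟩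
  obtain ⟨n, hyps, concl, hh, hcl, rfl⟩ := hT.2.1 σ hσ
  refine (realize_quasi A).2 fun v hv => ?_
  by_contra hnot
  obtain ⟨a, ha, hq⟩ := exists_conclusion_of_atomic hA hcl hnot
  obtain ⟨b, hb, hab, hroot⟩ := hA.exists_root v ha
  have hex : ∀ i, ∃ o, HasTemplate M b (v i) o := fun i => by
    rcases hroot i with ⟨w, hw⟩ | h
    · exact ⟨some w, hw⟩
    · exact ⟨none, h⟩
  choose c hc using hex
  obtain ⟨q, hqb, hqB⟩ := hq b hb hab c hc
  obtain ⟨p, hpb, hpB⟩ := exists_premise_of_list hA hb hc hyps hh hv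
  have hpq : rel T p (p ⊔ q) := by
    constructor
    · refine impl_mem hT fun B _ hBT hB y hy => hB.sup p q y hy (hqB B hB y ?_)
      exact (realize_quasi B).1 (hBT.realize_of_mem _ hσ) _ (hpB B hB y hy)
    · exact impl_mem hT fun B _ _ hB y hy => hB.mono _ _ _ le_sup_left hy
  exact hqb (hA.mono _ _ _ le_sup_right (hθ _ _ hpq b hpb))

theorem isQETheory_theoryOf (θ : S → S → Prop) : IsQETheory (baseTheory M) (theoryOf M θ) := by
  refine ⟨theoryOf_mono fun _ _ h => h.elim, fun σ hσ => hσ.1, fun σ hσ hmod =>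
    ⟨hσ, fun A _ hA hθ => ?_⟩⟩
  have : Nonempty A := ⟨pt M A⟩
  have : A ⊨ theoryOf M θ := ⟨fun τ hτ => hτ.2 A hA hθ⟩
  exact Theory.models_sentence_iff.1 hmod (Theory.ModelType.of _ A)

theorem isCong_rel (hT : IsQETheory (baseTheory M) T) :
    IsCong M (rel T) := by
  refine ⟨⟨fun s => ?_, fun h => ⟨h.2, h.1⟩, fun h h' => ?_⟩, fun s t r h => ?_,
    fun f hf s t h => ?_⟩
  · exact ⟨impl_mem hT fun _ _ _ _ _ hx => hx, impl_mem hT fun _ _ _ _ _ hx => hx⟩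
  · exact ⟨impl_mem hT fun A _ hA _ x hx =>
        holds_of_impl_mem h'.1 hA x (holds_of_impl_mem h.1 hA x hx),
      impl_mem hT fun A _ hA _ x hx =>
        holds_of_impl_mem h.2 hA x (holds_of_impl_mem h'.2 hA x hx)⟩
  · have key : ∀ {s t : S}, impl M s t ∈ T → impl M (s ⊔ r) (t ⊔ r) ∈ T := fun h =>
      impl_mem hT fun A _ hA hB x hx => hB.sup _ _ _
        (holds_of_impl_mem h hA x (hB.mono _ _ _ le_sup_left hx))
        (hB.mono _ _ _ le_sup_right hx)
    exact ⟨key h.1, key h.2⟩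
  · have key : ∀ {s t : S}, impl M s t ∈ T → impl M (f s) (f t) ∈ T := fun h =>
      impl_mem hT fun A _ hA hB x hx =>
        (hB.app_iff ⟨f, hf⟩ _ x).1 (holds_of_impl_mem h hA _ ((hB.app_iff ⟨f, hf⟩ _ x).2 hx))
    exact ⟨key h.1, key h.2⟩

end Theories

theorem isBase_free (hop : ∀ f ∈ M, IsOperator f) (htop : ∀ f ∈ M, f ⊤ = (⊤ : S)) {I : Set S}
    (hbot : ⊥ ∈ I) (hsup : ∀ s ∈ I, ∀ t ∈ I, s ⊔ t ∈ I) (hle : ∀ s t, s ≤ t → t ∈ I → s ∈ I)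
    (hI : ⊤ ∉ I) : IsBase M (Free M I) where
  bot x w _ := by rw [pull_bot hop]; exact hbot
  sup s t x hs ht w hw := by rw [pull_sup hop]; exact hsup _ (hs w hw) _ (ht w hw)
  mono s t x hst ht w hw := by
    refine hle _ _ ?_ (ht w hw)
    rw [← sup_eq_right, ← pull_sup hop, sup_of_le_right hst]
  app_iff f s x := by
    rcases x with _ | w
    · exact ⟨fun _ _ h => (Option.some_ne_none _ h.symm).elim,
        fun _ _ h => (Option.some_ne_none _ h.symm).elim⟩
    · constructor
      · intro h w' hw'
        obtain rfl : w = w' := Option.some_injective _ hw'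
        exact h (f :: w) rfl
      · intro h w' hw'
        obtain rfl : f :: w = w' := Option.some_injective _ hw'
        exact h w rfl
  app_pt f := rfl
  top_pt _ h := (Option.some_ne_none _ h.symm).elim
  eq_pt x h := by
    rcases x with _ | w
    · rfl
    · exact absurd (pull_top htop w ▸ h w rfl) hI
  app_inj f x y h := Option.map_injective List.cons_injective h
  app_ne f g x y hfg h := by
    rcases x with _ | w
    · rfl
    · rcases y with _ | w'
      · exact (Option.some_ne_none _ h).elim
      · exact absurd (List.cons.inj (Option.some_injective _ h)).1 hfg
  act_free u w x huw h := by
    rcases x with _ | z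
    · rfl
    · change act M u (Free.of I z) = act M w (Free.of I z) at h
      rw [act_free_of, act_free_of] at h
      exact absurd (List.append_cancel_right (Option.some_injective _ h)) huw

section Congruences

variable {θ : S → S → Prop}

theorem sup_related_of_impl_mem (hop : ∀ f ∈ M, IsOperator f) (htop : ∀ f ∈ M, f ⊤ = (⊤ : S))
    (hθ : IsCong M θ) {s t : S} (h : impl M s t ∈ theoryOf M θ) : θ (t ⊔ s) s := by
  obtain ⟨⟨hrefl, hsymm, htrans⟩, hsup, -⟩ := id hθ
  let I : Set S := {r | θ (r ⊔ s) s}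
  have hle : ∀ r r', r ≤ r' → r' ∈ I → r ∈ I := fun r r' hr hr' => by
    have h₁ : θ (r' ⊔ s ⊔ r) (s ⊔ r) := hsup _ _ r hr'
    rw [sup_right_comm, sup_eq_left.2 hr] at h₁
    exact htrans (sup_comm s r ▸ hsymm h₁) hr'
  by_cases hI : ⊤ ∈ I
  · exact hle t ⊤ le_top hI
  have hbase : IsBase M (Free M I) := by
    refine isBase_free hop htop ?_ (fun r hr r' hr' => ?_) hle hI
    · change θ (⊥ ⊔ s) s
      rw [bot_sup_eq]
      exact hrefl s
    · change θ (r ⊔ r' ⊔ s) s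
      have h₁ : θ (r ⊔ s ⊔ r') (s ⊔ r') := hsup _ _ r' hr
      rw [sup_right_comm, sup_comm s r'] at h₁
      exact htrans h₁ hr'
  have hmodel : ∀ a b, θ a b → ∀ x : Free M I, Holds M a x → Holds M b x := by
    intro a b hab x hx w hw
    exact htrans (hsymm (hsup _ _ s (pull_cong hθ w hab))) (hx w hw)
  refine realize_impl.1 (h.2 (Free M I) hbase hmodel) (Free.of I []) ?_ [] rfl
  intro w hw
  obtain rfl : [] = w := Option.some_injective _ hw
  change θ (s ⊔ s) s
  rw [sup_idem]
  exact hrefl s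

theorem rel_theoryOf (hop : ∀ f ∈ M, IsOperator f) (htop : ∀ f ∈ M, f ⊤ = (⊤ : S))
    (hθ : IsCong M θ) : rel (theoryOf M θ) = θ := by
  obtain ⟨⟨-, hsymm, htrans⟩, -, -⟩ := id hθ
  ext s t
  constructor
  · rintro ⟨hst, hts⟩
    have h₁ := sup_related_of_impl_mem hop htop hθ hst
    have h₂ := sup_related_of_impl_mem hop htop hθ hts
    rw [sup_comm] at h₂
    exact htrans (hsymm h₁) h₂
  · intro h
    exact ⟨⟨isQuasiIdentity_impl s t, fun A _ _ hA => realize_impl.2 (hA s t h)⟩,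
      ⟨isQuasiIdentity_impl t s, fun A _ _ hA => realize_impl.2 (hA t s (hsymm h))⟩⟩

end Congruences

theorem rel_le_rel_iff {T T' : (lang M).Theory} (hT : IsQETheory (baseTheory M) T)
    (hT' : IsQETheory (baseTheory M) T') : rel T ≤ rel T' ↔ T ⊆ T' := by
  refine ⟨fun h σ hσ => ?_, fun h s t hst => ⟨h hst.1, h hst.2⟩⟩
  refine mem_of_forall_models hT' (hT.2.1 σ hσ) fun A _ hA => ?_
  exact (subset_theoryOf_rel hT hσ).2 A (isBase_of_isQETheory hT' hA) fun s t hst x hx =>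
    holds_of_impl_mem (h s t hst).1 hA x hx

end OperatorModel

open OperatorModel in
/-- Let `S` be a join semilattice with least element `0` and
greatest element `1`, and let `M` be a monoid (under composition) of operators
on `S` that is reductive and right cancellative, with `f(1) = 1` for every
`f ∈ M`.  Then there exist a first-order language `L` and a set `T₀` of
quasi-identities in `L` such that the lattice `QTh(T₀)` of quasi-equational
theories extending `T₀`, ordered by inclusion, is order-isomorphic to
`Con(S,∨,0,M)`. -/
theorem qth_representation_of_reductive (S : Type u)
    [SemilatticeSup S] [OrderBot S] [OrderTop S] (M : Set (S → S))
    (hop : ∀ f ∈ M, IsOperator f)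
    (hid : id ∈ M)
    (hcomp : ∀ f ∈ M, ∀ g ∈ M, f ∘ g ∈ M)
    (hred : ∀ f ∈ M, ∀ g ∈ M, ∃ h ∈ M, f = h ∘ g ∨ g = h ∘ f)
    (hrc : ∀ f ∈ M, ∀ g ∈ M, ∀ h ∈ M, g ∘ f = h ∘ f → g = h)
    (htop : ∀ f ∈ M, f ⊤ = (⊤ : S)) :
    ∃ (L : FirstOrder.Language.{u, u}) (T₀ : L.Theory),
      (∀ σ ∈ T₀, IsQuasiIdentity σ) ∧
      Nonempty ({T : L.Theory // IsQETheory T₀ T} ≃o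
        {θ : S → S → Prop // IsCong M θ}) := by
  refine ⟨lang M, baseTheory M, fun σ hσ => hσ.1, ⟨RelIso.ofSurjective
    (OrderEmbedding.ofMapLEIff (fun T => ⟨rel T.1, isCong_rel T.2⟩)
      fun T T' => rel_le_rel_iff T.2 T'.2) fun θ => ?_⟩⟩
  exact ⟨⟨theoryOf M θ.1, isQETheory_theoryOf θ.1⟩, Subtype.ext (rel_theoryOf hop htop θ.2)⟩
end

section
/- Let S be a join semilattice with least element 0 and greatest element 1, and let G be a group (under composition) of operators on S such that g(0) = 0 and g(1) = 1 for every g ∈ G. Then there exist a first-order language L and a set T₀ of quasi-identities in L such that the lattice QTh(T₀) of quasi-equational theories extending T₀, ordered by inclusion, is order-isomorphic to Con(S,∨,0,G). -/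
open FirstOrder FirstOrder.Language

universe u

namespace GroupSemilattice

/-- Function symbols: a constant, and a unary symbol for each element of the group. -/
inductive Fn (H : Type u) : ℕ → Type u
  | pt : Fn H 0
  | act (g : H) : Fn H 1

/-- Relation symbols: a unary predicate for each element of the semilattice. -/
inductive Rl (S : Type u) : ℕ → Type u
  | mem (s : S) : Rl S 1

/-- The language with a constant, unary functions indexed by `H`, and unary predicates
indexed by `S`. -/
def lang (H S : Type u) : FirstOrder.Language.{u, u} := ⟨Fn H, Rl S⟩

section Interpretations

variable (H S : Type u) {M : Type u} [(lang H S).Structure M]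

/-- The interpretation of the constant. -/
def pt (M : Type u) [(lang H S).Structure M] : M :=
  Structure.funMap (L := lang H S) (M := M) (Fn.pt : Fn H 0) ![]

variable {H}

/-- The interpretation of the unary function indexed by `g`. -/
def act (g : H) (x : M) : M := Structure.funMap (L := lang H S) (Fn.act g : Fn H 1) ![x]

variable {S} (H)

/-- The interpretation of the unary predicate indexed by `s`. -/
def mem (s : S) (x : M) : Prop := Structure.RelMap (L := lang H S) (Rl.mem s : Rl S 1) ![x]

variable (S) {α : Type*}

/-- The constant, as a term. -/
def ptTerm : (lang H S).Term α := Term.func (L := lang H S) (Fn.pt : Fn H 0) ![]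

variable {H S}

/-- The application of the unary function symbol indexed by `g` to a term. -/
def actTerm (g : H) (t : (lang H S).Term α) : (lang H S).Term α :=
  Functions.apply₁ (L := lang H S) (Fn.act g : Fn H 1) t

/-- The unary predicate indexed by `s`, applied to a term. -/
def memFormula {n : ℕ} (s : S) (t : (lang H S).Term (α ⊕ Fin n)) :
    (lang H S).BoundedFormula α n :=
  Relations.boundedFormula₁ (L := lang H S) (Rl.mem s : Rl S 1) t

@[simp]
theorem realize_ptTerm (v : α → M) : (ptTerm H S).realize v = pt H S M := by
  simp only [ptTerm, Term.realize, pt]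
  congr 1
  exact Subsingleton.elim _ _

@[simp]
theorem realize_actTerm (g : H) (t : (lang H S).Term α) (v : α → M) :
    (actTerm g t).realize v = act S g (t.realize v) :=
  Term.realize_functions_apply₁

@[simp]
theorem realize_memFormula {n : ℕ} (s : S) (t : (lang H S).Term (α ⊕ Fin n)) (v : α → M)
    (xs : Fin n → M) :
    (memFormula s t).Realize v xs ↔ mem H s (t.realize (Sum.elim v xs)) :=
  BoundedFormula.realize_rel₁

theorem isAtomic_memFormula {n : ℕ} (s : S) (t : (lang H S).Term (α ⊕ Fin n)) :
    (memFormula s t).IsAtomic :=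
  .rel _ _

end Interpretations

/-- The universal closure of the implication from a list of formulas to a formula. -/
def implication {L : FirstOrder.Language.{u, u}} {n : ℕ} (hyps : List (L.BoundedFormula Empty n))
    (concl : L.BoundedFormula Empty n) : L.Sentence :=
  BoundedFormula.alls ((hyps.foldr (· ⊓ ·) ⊤).imp concl)

theorem realize_implication {L : FirstOrder.Language.{u, u}} {n : ℕ}
    (hyps : List (L.BoundedFormula Empty n)) (concl : L.BoundedFormula Empty n)
    (M : Type u) [L.Structure M] :
    M ⊨ implication hyps concl ↔ ∀ xs : Fin n → M,
      (∀ φ ∈ hyps, φ.Realize default xs) → concl.Realize default xs := by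
  exact BoundedFormula.realize_alls.trans (by simp)

variable {H S : Type u}

variable (H) in
/-- `θ`-related elements of `S` define the same subset of `M`. -/
def Saturated (θ : S → S → Prop) (M : Type u) [(lang H S).Structure M] : Prop :=
  ∀ s t, θ s t → ∀ x : M, mem H s x ↔ mem H t x

/-- The relation identifying elements of `S` whose predicates agree in all models of `T`. -/
def congOf (T : (lang H S).Theory) (s t : S) : Prop :=
  ∀ (M : Type u) [(lang H S).Structure M], M ⊨ T → ∀ x : M, mem H s x ↔ mem H t x

theorem congOf_mono {T T' : (lang H S).Theory} (h : T ⊆ T') (s t : S) (hst : congOf T s t) :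
    congOf T' s t :=
  fun M _ hM => hst M (hM.mono h)

theorem equivalence_congOf (T : (lang H S).Theory) : Equivalence (congOf T) where
  refl _ _ _ _ _ := Iff.rfl
  symm h M _ hM x := (h M hM x).symm
  trans h h' M _ hM x := (h M hM x).trans (h' M hM x)

theorem models_iff {T : (lang H S).Theory} {σ : (lang H S).Sentence} :
    T ⊨ᵇ σ ↔ ∀ (M : Type u) [(lang H S).Structure M], M ⊨ T → M ⊨ σ := by
  rw [Theory.models_sentence_iff]
  refine ⟨fun h M _ hM => ?_, fun h M => h M M.is_model⟩
  have : Nonempty M := ⟨pt H S M⟩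
  exact h (Theory.ModelType.of T M)

/-- `f` respects the functions, maps `a` to `m`, and collapses everything outside the orbit of `a`
to the base point. -/
structure IsOrbitMap {N M : Type u} [(lang H S).Structure N] [(lang H S).Structure M]
    (a : N) (m : M) (f : N → M) : Prop where
  map_pt : f (pt H S N) = pt H S M
  map_act (g : H) (x : N) : f (act S g x) = act S g (f x)
  map_base : f a = m
  orbit_or (x : N) : (∃ g : H, x = act S g a) ∨ f x = pt H S M

theorem IsOrbitMap.realize_term {N M : Type u} [(lang H S).Structure N]
    [(lang H S).Structure M] {a : N} {m : M} {f : N → M}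
    (hf : IsOrbitMap (H := H) (S := S) a m f)
    {α : Type*} (t : (lang H S).Term α) (v : α → N) :
    t.realize (f ∘ v) = f (t.realize v) := by
  induction t with
  | var i => rfl
  | @func n F ts ih =>
    cases F with
    | pt =>
      have hN : Term.realize v (Term.func (L := lang H S) (Fn.pt : Fn H 0) ts) = pt H S N :=
        congrArg (Structure.funMap (L := lang H S) (Fn.pt : Fn H 0)) (Subsingleton.elim _ _)
      have hM : Term.realize (f ∘ v) (Term.func (L := lang H S) (Fn.pt : Fn H 0) ts) = pt H S M :=
        congrArg (Structure.funMap (L := lang H S) (Fn.pt : Fn H 0)) (Subsingleton.elim _ _)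
      exact hM.trans (hf.map_pt.symm.trans (congrArg f hN.symm))
    | act g =>
      have hts : ts = ![ts 0] := by
        ext i; fin_cases i; rfl
      have h0 := ih 0
      rw [hts]
      exact (realize_actTerm g (ts 0) (f ∘ v)).trans ((congrArg (act S g) h0).trans
        ((hf.map_act g _).symm.trans (congrArg f (realize_actTerm g (ts 0) v).symm)))

theorem sumElim_default_comp {N M : Type*} {n : ℕ} (f : N → M) (v : Fin n → N) :
    Sum.elim (default : Empty → M) (f ∘ v) = f ∘ Sum.elim default v := by
  ext (i | i)
  · exact i.elim
  · rfl

variable [Group H] [SemilatticeSup S] [BoundedOrder S] [MulAction H S]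

variable (H S) in
/-- A pointed `H`-set, free away from the base point, whose points carry ideals of `S` in an
equivariant way, the base point being the only one to carry the improper ideal. -/
structure IsIdealSet (M : Type u) [(lang H S).Structure M] : Prop where
  one_act (x : M) : act S (1 : H) x = x
  act_act (g h : H) (x : M) : act S g (act S h x) = act S (g * h) x
  act_pt (g : H) : act S g (pt H S M) = pt H S M
  mem_bot (x : M) : mem H (⊥ : S) x
  mem_of_le {s t : S} (hst : s ≤ t) {x : M} (hx : mem H t x) : mem H s x
  mem_sup {s t : S} {x : M} (hs : mem H s x) (ht : mem H t x) : mem H (s ⊔ t) x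
  mem_act (g : H) {s : S} {x : M} (hx : mem H s x) : mem H (g • s) (act S g x)
  mem_pt (s : S) : mem H s (pt H S M)
  eq_pt {x : M} (hx : mem H (⊤ : S) x) : x = pt H S M
  free {g : H} (hg : g ≠ 1) {x : M} (hx : act S g x = x) : x = pt H S M

variable (H) in
/-- The quasi-identities true in all `θ`-saturated structures satisfying `IsIdealSet`. -/
def theoryOf (θ : S → S → Prop) : (lang H S).Theory :=
  {σ | IsQuasiIdentity σ ∧ ∀ (M : Type u) [(lang H S).Structure M],
    IsIdealSet H S M → Saturated H θ M → M ⊨ σ}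

theorem theoryOf_mono {θ θ' : S → S → Prop} (h : ∀ s t, θ s t → θ' s t) :
    theoryOf H θ ⊆ theoryOf H θ' :=
  fun _ hσ => ⟨hσ.1, fun M _ hM hs => hσ.2 M hM fun s t hst => hs s t (h s t hst)⟩

theorem realize_of_models_theoryOf {θ : S → S → Prop} {M : Type u} [(lang H S).Structure M]
    (hM : M ⊨ theoryOf H θ) (hyps : List ((lang H S).BoundedFormula Empty 1))
    (concl : (lang H S).BoundedFormula Empty 1) (hh : ∀ φ ∈ hyps, φ.IsAtomic)
    (hc : concl.IsAtomic)
    (h : ∀ (N : Type u) [(lang H S).Structure N], IsIdealSet H S N → Saturated H θ N →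
      ∀ x : N, (∀ φ ∈ hyps, φ.Realize default ![x]) → concl.Realize default ![x])
    (x : M) (hx : ∀ φ ∈ hyps, φ.Realize default ![x]) : concl.Realize default ![x] := by
  refine (realize_implication hyps concl M).1 (hM.realize_of_mem _ ?_) ![x] hx
  refine ⟨⟨1, hyps, concl, hh, hc, rfl⟩, fun N _ hN hs => ?_⟩
  refine (realize_implication hyps concl N).2 fun xs => ?_
  have hxs : xs = ![xs 0] := by
    ext i; fin_cases i; rfl
  rw [hxs]
  exact h N hN hs (xs 0)

theorem isIdealSet_of_models {θ : S → S → Prop} {M : Type u} [(lang H S).Structure M]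
    (hM : M ⊨ theoryOf H θ) : IsIdealSet H S M where
  one_act x := by
    simpa using realize_of_models_theoryOf hM [] ((actTerm 1 (&0)).bdEqual (&0)) (by simp)
      (.equal _ _) (fun N _ hN _ x => by simpa using hN.one_act x) x (by simp)
  act_act g h x := by
    simpa using realize_of_models_theoryOf hM []
      ((actTerm g (actTerm h (&0))).bdEqual (actTerm (g * h) (&0))) (by simp)
      (.equal _ _) (fun N _ hN _ x => by simpa using hN.act_act g h x) x (by simp)
  act_pt g := by
    simpa using realize_of_models_theoryOf hM []
      ((actTerm g (ptTerm H S)).bdEqual (ptTerm H S)) (by simp)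
      (.equal _ _) (fun N _ hN _ x => by simpa using hN.act_pt g) (pt H S M) (by simp)
  mem_bot x := by
    simpa using realize_of_models_theoryOf hM [] (memFormula ⊥ (&0)) (by simp)
      (isAtomic_memFormula _ _) (fun N _ hN _ x => by simpa using hN.mem_bot x) x (by simp)
  mem_of_le {s t} hst x hx := by
    simpa using realize_of_models_theoryOf hM [memFormula t (&0)] (memFormula s (&0))
      (by simp [isAtomic_memFormula]) (isAtomic_memFormula _ _)
      (fun N _ hN _ x => by simpa using hN.mem_of_le hst) x (by simpa using hx)
  mem_sup {s t x} hs ht := by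
    simpa using realize_of_models_theoryOf hM [memFormula s (&0), memFormula t (&0)]
      (memFormula (s ⊔ t) (&0))
      (by simp [isAtomic_memFormula]) (isAtomic_memFormula _ _)
      (fun N _ hN _ x => by simpa using hN.mem_sup) x (by simpa using ⟨hs, ht⟩)
  mem_act g s x hx := by
    simpa using realize_of_models_theoryOf hM [memFormula s (&0)]
      (memFormula (g • s) (actTerm g (&0)))
      (by simp [isAtomic_memFormula]) (isAtomic_memFormula _ _)
      (fun N _ hN _ x => by simpa using hN.mem_act g) x (by simpa using hx)
  mem_pt s := by
    simpa using realize_of_models_theoryOf hM [] (memFormula s (ptTerm H S)) (by simp)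
      (isAtomic_memFormula _ _) (fun N _ hN _ x => by simpa using hN.mem_pt s) (pt H S M) (by simp)
  eq_pt {x} hx := by
    simpa using realize_of_models_theoryOf hM [memFormula ⊤ (&0)] ((&0).bdEqual (ptTerm H S))
      (by simp [isAtomic_memFormula]) (.equal _ _)
      (fun N _ hN _ x => by simpa using hN.eq_pt) x (by simpa using hx)
  free {g} hg x hx := by
    simpa using realize_of_models_theoryOf hM [(actTerm g (&0)).bdEqual (&0)]
      ((&0).bdEqual (ptTerm H S))
      (by simpa using .equal _ _) (.equal _ _)
      (fun N _ hN _ x => by simpa using hN.free hg) x (by simpa using hx)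

theorem saturated_of_models {θ : S → S → Prop} (hsymm : ∀ s t, θ s t → θ t s) {M : Type u}
    [(lang H S).Structure M] (hM : M ⊨ theoryOf H θ) : Saturated H θ M := by
  have key : ∀ s t, θ s t → ∀ x : M, mem H s x → mem H t x := fun s t hst x hx => by
    simpa using realize_of_models_theoryOf hM [memFormula s (&0)] (memFormula t (&0))
      (by simp [isAtomic_memFormula]) (isAtomic_memFormula _ _)
      (fun N _ _ hN x => by simpa using (hN s t hst x).1) x (by simpa using hx)
  exact fun s t hst x => ⟨key s t hst x, key t s (hsymm s t hst) x⟩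

theorem isIdealSet_of_subset {T : (lang H S).Theory} (hT : theoryOf H (S := S) Eq ⊆ T)
    {M : Type u} [(lang H S).Structure M] (hM : M ⊨ T) : IsIdealSet H S M :=
  isIdealSet_of_models (hM.mono hT)

namespace IsIdealSet

variable {M : Type u} [(lang H S).Structure M]

theorem mem_sup_iff (hM : IsIdealSet H S M) {s t : S} {x : M} :
    mem H (s ⊔ t) x ↔ mem H s x ∧ mem H t x :=
  ⟨fun h => ⟨hM.mem_of_le le_sup_left h, hM.mem_of_le le_sup_right h⟩,
    fun h => hM.mem_sup h.1 h.2⟩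

theorem mem_act_iff (hM : IsIdealSet H S M) {g : H} {s : S} {x : M} :
    mem H s (act S g x) ↔ mem H (g⁻¹ • s) x := by
  refine ⟨fun h => ?_, fun h => ?_⟩
  · simpa [hM.act_act, hM.one_act] using hM.mem_act g⁻¹ h
  · simpa using hM.mem_act g h

theorem mem_top_iff (hM : IsIdealSet H S M) {x : M} : mem H (⊤ : S) x ↔ x = pt H S M :=
  ⟨hM.eq_pt, fun h => h ▸ hM.mem_pt ⊤⟩

theorem act_injective (hM : IsIdealSet H S M) {a : M} (ha : a ≠ pt H S M) {g h : H}
    (hgh : act S g a = act S h a) : g = h := by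
  by_contra hne
  refine ha (hM.free (g := h⁻¹ * g) (fun h1 => hne (inv_mul_eq_one.1 h1).symm) ?_)
  rw [← hM.act_act, hgh, hM.act_act, inv_mul_cancel, hM.one_act]

end IsIdealSet

theorem exists_isOrbitMap {N M : Type u} [(lang H S).Structure N] [(lang H S).Structure M]
    (hN : IsIdealSet H S N) (hM : IsIdealSet H S M) {a : N}
    (ha : a ≠ pt H S N) (m : M) : ∃ f : N → M, IsOrbitMap (H := H) (S := S) a m f := by
  classical
  let f : N → M := fun x => if h : ∃ g : H, x = act S g a then act S h.choose m else pt H S M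
  have hf (g : H) : f (act S g a) = act S g m := by
    have h : ∃ g' : H, act S g a = act S g' a := ⟨g, rfl⟩
    have hg : h.choose = g := (hN.act_injective ha h.choose_spec).symm
    simp only [f, dif_pos h, hg]
  have hf' {x : N} (h : ¬ ∃ g : H, x = act S g a) : f x = pt H S M := dif_neg h
  refine ⟨f, hf' ?_, fun g x => ?_, ?_, fun x => ?_⟩
  · rintro ⟨g, hg⟩
    apply ha
    rw [← hN.one_act a, ← inv_mul_cancel g, ← hN.act_act, ← hg, hN.act_pt]
  · by_cases h : ∃ g : H, x = act S g a
    · obtain ⟨k, rfl⟩ := h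
      rw [hN.act_act, hf, hf, hM.act_act]
    · rw [hf' h, hM.act_pt]
      refine hf' ?_
      rintro ⟨k, hk⟩
      exact h ⟨g⁻¹ * k, by rw [← hN.act_act, ← hk, hN.act_act, inv_mul_cancel, hN.one_act]⟩
  · simpa [hN.one_act, hM.one_act] using hf 1
  · by_cases h : ∃ g : H, x = act S g a
    · exact Or.inl h
    · exact Or.inr (hf' h)

theorem exists_bound_of_isAtomic {N : Type u} [(lang H S).Structure N] (hN : IsIdealSet H S N)
    (a : N) {n : ℕ} (v : Fin n → N) {φ : (lang H S).BoundedFormula Empty n} (hφ : φ.IsAtomic)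
    (hv : φ.Realize default v) :
    ∃ s : S, mem H s a ∧ ∀ (M : Type u) [(lang H S).Structure M], IsIdealSet H S M →
      ∀ (m : M) (f : N → M), IsOrbitMap (H := H) (S := S) a m f → mem H s m →
        φ.Realize default (f ∘ v) := by
  cases hφ with
  | equal t₁ t₂ =>
    refine ⟨⊥, hN.mem_bot a, fun M _ _ m f hf _ => ?_⟩
    rw [BoundedFormula.realize_bdEqual] at hv ⊢
    rw [sumElim_default_comp, hf.realize_term, hf.realize_term, hv]
  | rel R ts =>
    obtain ⟨q⟩ := R
    have hts : ts = ![ts 0] := by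
      ext i; fin_cases i; rfl
    rw [hts] at hv ⊢
    change (memFormula q (ts 0)).Realize default v at hv
    change ∃ s : S, mem H s a ∧ ∀ (M : Type u) [(lang H S).Structure M], IsIdealSet H S M →
      ∀ (m : M) (f : N → M), IsOrbitMap (H := H) (S := S) a m f → mem H s m →
        (memFormula q (ts 0)).Realize default (f ∘ v)
    simp only [realize_memFormula, sumElim_default_comp] at hv ⊢
    by_cases h : ∃ g : H, (ts 0).realize (Sum.elim default v) = act S g a
    · obtain ⟨g, hg⟩ := h
      refine ⟨g⁻¹ • q, hN.mem_act_iff.1 (hg ▸ hv), fun M _ hM m f hf hm => ?_⟩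
      rw [hf.realize_term, hg, hf.map_act, hf.map_base]
      exact hM.mem_act_iff.2 hm
    · refine ⟨⊥, hN.mem_bot a, fun M _ hM m f hf hm => ?_⟩
      rw [hf.realize_term, (hf.orbit_or _).resolve_left h]
      exact hM.mem_pt q

theorem exists_bound_of_forall_isAtomic {N : Type u} [(lang H S).Structure N]
    (hN : IsIdealSet H S N)
    (a : N) {n : ℕ} (v : Fin n → N) (l : List ((lang H S).BoundedFormula Empty n))
    (hl : ∀ φ ∈ l, φ.IsAtomic) (hv : ∀ φ ∈ l, φ.Realize default v) :
    ∃ s : S, mem H s a ∧ ∀ (M : Type u) [(lang H S).Structure M], IsIdealSet H S M →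
      ∀ (m : M) (f : N → M), IsOrbitMap (H := H) (S := S) a m f → mem H s m →
        ∀ φ ∈ l, φ.Realize default (f ∘ v) := by
  induction l with
  | nil => exact ⟨⊥, hN.mem_bot a, by simp⟩
  | cons φ l ih =>
    simp only [List.mem_cons, forall_eq_or_imp] at hl hv ⊢
    obtain ⟨s, hs, hs'⟩ := exists_bound_of_isAtomic hN a v hl.1 hv.1
    obtain ⟨t, ht, ht'⟩ := ih hl.2 hv.2
    refine ⟨s ⊔ t, hN.mem_sup hs ht, fun M _ hM m f hf hm => ?_⟩
    rw [hM.mem_sup_iff] at hm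
    exact ⟨hs' M hM m f hf hm.1, ht' M hM m f hf hm.2⟩

/-- If `v` satisfies the premise of a quasi-identity of `T` and `r` fails at `a`, then some orbit
map sends `a` to a point where `r` fails, and sends `v` to a tuple satisfying the conclusion. -/
theorem exists_orbitMap_of_not_mem {T : (lang H S).Theory} (hT : theoryOf H (S := S) Eq ⊆ T)
    {N : Type u} [(lang H S).Structure N] (hN : IsIdealSet H S N) (hs : Saturated H (congOf T) N)
    {n : ℕ} {hyps : List ((lang H S).BoundedFormula Empty n)}
    {concl : (lang H S).BoundedFormula Empty n} (hh : ∀ φ ∈ hyps, φ.IsAtomic)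
    (hmem : implication hyps concl ∈ T) {v : Fin n → N} (hv : ∀ φ ∈ hyps, φ.Realize default v)
    {a : N} {r : S} (hr : ¬ mem H r a) :
    ∃ (M : Type u) (_ : (lang H S).Structure M) (m : M) (f : N → M), IsIdealSet H S M ∧
      IsOrbitMap (H := H) (S := S) a m f ∧ ¬ mem H r m ∧ concl.Realize default (f ∘ v) := by
  obtain ⟨s, hsa, hs'⟩ := exists_bound_of_forall_isAtomic hN a v hyps hh hv
  have hnot : ¬ congOf T s (s ⊔ r) := fun h =>
    hr (hN.mem_sup_iff.1 ((hs _ _ h a).1 hsa)).2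
  simp only [congOf, not_forall] at hnot
  obtain ⟨M, instM, hMT, m, hm⟩ := hnot
  have hM := isIdealSet_of_subset hT hMT
  rw [hM.mem_sup_iff] at hm
  have ha : a ≠ pt H S N := fun h => hr (h ▸ hN.mem_pt r)
  obtain ⟨f, hf⟩ := exists_isOrbitMap hN hM ha m
  refine ⟨M, instM, m, f, hM, hf, by tauto, ?_⟩
  exact (realize_implication hyps concl M).1 (hMT.realize_of_mem _ hmem) _
    (hs' M hM m f hf (by tauto))

theorem realize_of_saturated {T : (lang H S).Theory} (hT : theoryOf H (S := S) Eq ⊆ T)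
    {N : Type u} [(lang H S).Structure N] (hN : IsIdealSet H S N) (hs : Saturated H (congOf T) N)
    {σ : (lang H S).Sentence} (hσ : IsQuasiIdentity σ) (hmem : σ ∈ T) : N ⊨ σ := by
  obtain ⟨n, hyps, concl, hh, hc, rfl⟩ := hσ
  refine (realize_implication hyps concl N).2 fun v hv => ?_
  cases hc with
  | equal t₁ t₂ =>
    rw [BoundedFormula.realize_bdEqual]
    set a := t₁.realize (Sum.elim default v) with ha
    set b := t₂.realize (Sum.elim default v) with hb
    have collapse {M : Type u} [(lang H S).Structure M] {m : M} {c d : N} {f : N → M}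
        (hM : IsIdealSet H S M) (hf : IsOrbitMap (H := H) (S := S) c m f)
        (hm : ¬ mem H (⊤ : S) m) (hcd : f c = f d) : d = c := by
      rw [hM.mem_top_iff] at hm
      rw [hf.map_base] at hcd
      rcases hf.orbit_or d with ⟨g, rfl⟩ | hd
      · rw [hf.map_act, hf.map_base] at hcd
        have hg : (1 : H) = g := hM.act_injective hm (by rw [hM.one_act, ← hcd])
        rw [← hg, hN.one_act]
      · exact absurd (hcd.trans hd) hm
    by_cases h1 : mem H (⊤ : S) a
    · by_cases h2 : mem H (⊤ : S) b
      · exact (hN.eq_pt h1).trans (hN.eq_pt h2).symm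
      · obtain ⟨M, _, m, f, hM, hf, hm, hc⟩ := exists_orbitMap_of_not_mem hT hN hs hh hmem hv h2
        rw [BoundedFormula.realize_bdEqual, sumElim_default_comp, hf.realize_term,
          hf.realize_term] at hc
        exact collapse hM hf hm hc.symm
    · obtain ⟨M, _, m, f, hM, hf, hm, hc⟩ := exists_orbitMap_of_not_mem hT hN hs hh hmem hv h1
      rw [BoundedFormula.realize_bdEqual, sumElim_default_comp, hf.realize_term,
        hf.realize_term] at hc
      exact (collapse hM hf hm hc).symm
  | rel R ts =>
    obtain ⟨r⟩ := R
    have hts : ts = ![ts 0] := by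
      ext i; fin_cases i; rfl
    rw [hts] at hmem ⊢
    change (memFormula r (ts 0)).Realize default v
    rw [realize_memFormula]
    by_contra hr
    obtain ⟨M, _, m, f, hM, hf, hm, hc⟩ := exists_orbitMap_of_not_mem hT hN hs hh hmem hv hr
    change (memFormula r (ts 0)).Realize default (f ∘ v) at hc
    rw [realize_memFormula, sumElim_default_comp, hf.realize_term, hf.map_base] at hc
    exact hm hc

theorem isQETheory_theoryOf (θ : S → S → Prop) (hrefl : ∀ s, θ s s) :
    IsQETheory (theoryOf H (S := S) Eq) (theoryOf H θ) := by
  refine ⟨theoryOf_mono fun s t h => h ▸ hrefl s, fun σ hσ => hσ.1, fun σ hσ h => ⟨hσ, ?_⟩⟩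
  intro M _ hM hs
  exact models_iff.1 h M ((Theory.model_iff _).2 fun τ hτ => hτ.2 M hM hs)

theorem subset_of_congOf_le {T T' : (lang H S).Theory}
    (hT : IsQETheory (theoryOf H (S := S) Eq) T) (hT' : IsQETheory (theoryOf H (S := S) Eq) T')
    (h : ∀ s t, congOf T s t → congOf T' s t) : T ⊆ T' := by
  intro σ hσ
  refine hT'.2.2 σ (hT.2.1 σ hσ) (models_iff.2 fun M _ hM => ?_)
  exact realize_of_saturated hT.1 (isIdealSet_of_subset hT'.1 hM)
    (fun s t hst => h s t hst M hM) (hT.2.1 σ hσ) hσ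

theorem congOf_sup {T : (lang H S).Theory} (hT : theoryOf H (S := S) Eq ⊆ T) {s t : S} (r : S)
    (h : congOf T s t) : congOf T (s ⊔ r) (t ⊔ r) := fun M _ hM x => by
  have hM' := isIdealSet_of_subset hT hM
  rw [hM'.mem_sup_iff, hM'.mem_sup_iff, h M hM x]

theorem congOf_smul {T : (lang H S).Theory} (hT : theoryOf H (S := S) Eq ⊆ T) (g : H) {s t : S}
    (h : congOf T s t) : congOf T (g • s) (g • t) := fun M _ hM x => by
  have hM' := isIdealSet_of_subset hT hM
  have key (r : S) : mem H (g • r) x ↔ mem H r (act S g⁻¹ x) := by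
    rw [hM'.mem_act_iff, inv_inv]
  rw [key, key, h M hM]

/-- The structure on `H` with a base point added in which the identity of `H` carries the
ideal `I`. -/
@[reducible]
def idealStructure (H : Type u) [Group H] [MulAction H S] (I : S → Prop) :
    (lang H S).Structure (Option H) where
  funMap := fun {_} F => match F with
    | Fn.pt => fun _ => none
    | Fn.act g => fun v => (v 0).map (g * ·)
  RelMap := fun {_} R => match R with
    | Rl.mem s => fun v => ∀ h : H, v 0 = some h → I (h⁻¹ • s)

theorem isIdealSet_idealStructure (hsup : ∀ (g : H) (s t : S), g • (s ⊔ t) = g • s ⊔ g • t)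
    (hbot : ∀ g : H, g • (⊥ : S) = ⊥) (htop : ∀ g : H, g • (⊤ : S) = ⊤) (I : S → Prop)
    (Ibot : I ⊥) (Ile : ∀ s t, s ≤ t → I t → I s) (Isup : ∀ s t, I s → I t → I (s ⊔ t))
    (Itop : ¬ I ⊤) :
    let _ := idealStructure H I
    IsIdealSet H S (Option H) := by
  let _ := idealStructure H I
  have act_def (g : H) (x : Option H) : act S g x = x.map (g * ·) := rfl
  have pt_def : pt H S (Option H) = none := rfl
  have mem_def (s : S) (x : Option H) : mem H s x ↔ ∀ h : H, x = some h → I (h⁻¹ • s) := Iff.rfl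
  have mono (g : H) {s t : S} (hst : s ≤ t) : g • s ≤ g • t := by
    rw [← sup_eq_right] at hst ⊢
    rw [← hsup, hst]
  constructor
  · rintro (_ | x) <;> simp [act_def]
  · rintro g h (_ | x) <;> simp [act_def, mul_assoc]
  · intro g
    rfl
  · intro x
    simpa [mem_def, hbot] using fun _ _ => Ibot
  · intro s t hst x hx h hh
    exact Ile _ _ (mono _ hst) (hx h hh)
  · intro s t x hs ht h hh
    rw [hsup]
    exact Isup _ _ (hs h hh) (ht h hh)
  · rintro g s (_ | x) hx
    · simp [mem_def, act_def]
    · simpa [mem_def, act_def, mul_smul] using hx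
  · simp [mem_def, pt_def]
  · rintro (_ | x) hx
    · rfl
    · exact absurd (hx x rfl) (by rwa [htop])
  · rintro g hg (_ | x) hx
    · rfl
    · simp [act_def, hg] at hx

theorem le_of_congOf_theoryOf (hsup : ∀ (g : H) (s t : S), g • (s ⊔ t) = g • s ⊔ g • t)
    (hbot : ∀ g : H, g • (⊥ : S) = ⊥) (htop : ∀ g : H, g • (⊤ : S) = ⊤) {θ : S → S → Prop}
    (hθ : Equivalence θ) (θsup : ∀ x y s : S, θ x y → θ (x ⊔ s) (y ⊔ s))
    (θsmul : ∀ (g : H) (x y : S), θ x y → θ (g • x) (g • y)) {s t : S}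
    (h : congOf (theoryOf H θ) s t) : θ s (s ⊔ t) := by
  by_contra hst
  let I : S → Prop := fun r => θ s (s ⊔ r)
  have Ile (p q : S) (hpq : p ≤ q) (hq : I q) : I p := by
    have h1 := θsup _ _ p hq
    rw [sup_assoc, sup_eq_left.2 hpq] at h1
    exact hθ.trans hq (hθ.symm h1)
  have Isat (p q : S) (hpq : θ p q) (hp : I p) : I q := by
    have h1 := θsup _ _ s hpq
    rw [sup_comm p, sup_comm q] at h1
    exact hθ.trans hp h1
  let _ := idealStructure H I
  have hI : IsIdealSet H S (Option H) := by
    refine isIdealSet_idealStructure hsup hbot htop I ?_ Ile (fun p q hp hq => ?_)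
      fun hT => hst (Ile _ _ le_top hT)
    · simpa [I] using hθ.refl s
    · have h1 := θsup _ _ q hp
      rw [sup_assoc] at h1
      exact hθ.trans hq h1
  have hsat : Saturated H θ (Option H) := fun p q hpq x =>
    ⟨fun hx k hk => Isat _ _ (θsmul _ _ _ hpq) (hx k hk),
      fun hx k hk => Isat _ _ (θsmul _ _ _ (hθ.symm hpq)) (hx k hk)⟩
  have hmodel : Option H ⊨ theoryOf H θ :=
    (Theory.model_iff _).2 fun σ hσ => hσ.2 _ hI hsat
  have hs : mem H s (some 1 : Option H) := by
    rintro k hk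
    obtain rfl : (1 : H) = k := by simpa using hk
    simpa [I] using hθ.refl s
  exact hst (by simpa using (h _ hmodel _).1 hs 1 rfl)

theorem congOf_theoryOf (hsup : ∀ (g : H) (s t : S), g • (s ⊔ t) = g • s ⊔ g • t)
    (hbot : ∀ g : H, g • (⊥ : S) = ⊥) (htop : ∀ g : H, g • (⊤ : S) = ⊤) {θ : S → S → Prop}
    (hθ : Equivalence θ) (θsup : ∀ x y s : S, θ x y → θ (x ⊔ s) (y ⊔ s))
    (θsmul : ∀ (g : H) (x y : S), θ x y → θ (g • x) (g • y)) :
    congOf (theoryOf H θ) = θ := by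
  ext s t
  refine ⟨fun h => ?_, fun h M _ hM => saturated_of_models (fun _ _ => hθ.symm) hM s t h⟩
  have h1 := le_of_congOf_theoryOf hsup hbot htop hθ θsup θsmul h
  have h2 := le_of_congOf_theoryOf hsup hbot htop hθ θsup θsmul ((equivalence_congOf _).symm h)
  rw [sup_comm] at h2
  exact hθ.trans h1 (hθ.symm h2)

/-- Quasi-equational theories of ideal sets correspond to `H`-invariant congruences of `S`. -/
theorem nonempty_orderIso (hsup : ∀ (g : H) (s t : S), g • (s ⊔ t) = g • s ⊔ g • t)
    (hbot : ∀ g : H, g • (⊥ : S) = ⊥) (htop : ∀ g : H, g • (⊤ : S) = ⊤) :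
    Nonempty ({T : (lang H S).Theory // IsQETheory (theoryOf H (S := S) Eq) T} ≃o
      {θ : S → S → Prop // IsCong (Set.range fun (g : H) (s : S) => g • s) θ}) := by
  let F : {T : (lang H S).Theory // IsQETheory (theoryOf H (S := S) Eq) T} ↪o
      {θ : S → S → Prop // IsCong (Set.range fun (g : H) (s : S) => g • s) θ} :=
    OrderEmbedding.ofMapLEIff
      (fun T => ⟨congOf T.1, equivalence_congOf T.1, fun _ _ r h => congOf_sup T.2.1 r h, by
        rintro _ ⟨g, rfl⟩ x y h
        exact congOf_smul T.2.1 g h⟩)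
      fun T T' => ⟨fun h => subset_of_congOf_le T.2 T'.2 h, fun h => congOf_mono h⟩
  refine ⟨RelIso.ofSurjective F fun ⟨θ, hθ, θsup, θsmul⟩ =>
    ⟨⟨theoryOf H θ, isQETheory_theoryOf θ hθ.refl⟩, Subtype.ext ?_⟩⟩
  exact congOf_theoryOf hsup hbot htop hθ θsup fun g x y h => θsmul _ ⟨g, rfl⟩ x y h

end GroupSemilattice

/-- Let `S` be a join semilattice with least element `0` and
greatest element `1`, and let `G` be a group (under composition) of operators
on `S` such that `g(0) = 0` and `g(1) = 1` for every `g ∈ G`.  Then there exist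
a first-order language `L` and a set `T₀` of quasi-identities in `L` such that
the lattice `QTh(T₀)` of quasi-equational theories extending `T₀`, ordered by
inclusion, is order-isomorphic to `Con(S,∨,0,G)`. -/
theorem qth_representation_of_group (S : Type u)
    [SemilatticeSup S] [OrderBot S] [OrderTop S] (G : Set (S → S))
    (hop : ∀ g ∈ G, IsOperator g)
    (hid : id ∈ G)
    (hcomp : ∀ f ∈ G, ∀ g ∈ G, f ∘ g ∈ G)
    (hinv : ∀ f ∈ G, ∃ g ∈ G, f ∘ g = id ∧ g ∘ f = id)
    (hbot : ∀ g ∈ G, g ⊥ = (⊥ : S))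
    (htop : ∀ g ∈ G, g ⊤ = (⊤ : S)) :
    ∃ (L : FirstOrder.Language.{u, u}) (T₀ : L.Theory),
      (∀ σ ∈ T₀, IsQuasiIdentity σ) ∧
      Nonempty ({T : L.Theory // IsQETheory T₀ T} ≃o
        {θ : S → S → Prop // IsCong G θ}) := by
  let H : Subgroup (Equiv.Perm S) :=
    { carrier := {e | ⇑e ∈ G}
      mul_mem' := fun {a b} ha hb => hcomp _ ha _ hb
      one_mem' := hid
      inv_mem' := fun {e} he => by
        obtain ⟨f, hf, h, -⟩ := hinv _ he
        have hef : ⇑e⁻¹ = f := by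
          ext x
          exact (Equiv.symm_apply_eq e).2 (congrFun h x).symm
        exact (congrArg (· ∈ G) hef).mpr hf }
  have hrange : (Set.range fun (g : H) (s : S) => g • s) = G := by
    ext f
    constructor
    · rintro ⟨g, rfl⟩
      exact g.2
    · intro hf
      obtain ⟨k, -, h, h'⟩ := hinv f hf
      exact ⟨⟨⟨f, k, congrFun h', congrFun h⟩, hf⟩, rfl⟩
  let _ : BoundedOrder S := { ‹OrderBot S›, ‹OrderTop S› with }
  refine ⟨GroupSemilattice.lang H S, GroupSemilattice.theoryOf H Eq, fun σ hσ => hσ.1, ?_⟩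
  rw [← hrange]
  exact GroupSemilattice.nonempty_orderIso (fun g => (hop _ g.2).1) (fun g => hbot _ g.2)
    fun g => htop _ g.2
end
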